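/- Let G=(V,E) be a d-manifold and let x be a simplex of G of dimension m. In the Barycentric refinement G1, let S^-(x) be the subgraph induced by the nonempty proper subsets of x and S^+(x) the subgraph induced by the simplices of G strictly containing x. Then S^-(x) is an (m−1)-sphere, S^+(x) is a (d−m−1)-sphere, and the unit sphere of the vertex x in G1 is isomorphic to the Zykov join S^-(x) ⊕ S^+(x). -/

import Mathlib

open scoped Classical

/-- A finite simple graph: a finite vertex set together with a symmetric, irreflexive
adjacency relation supported on the vertex set. -/
structure FGraph (V : Type) where
  verts : Finset V
  Adj : V → V → Prop
  symm : ∀ {a b}, Adj a b → Adj b a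
  loopless : ∀ a, ¬ Adj a a
  mem_of_adj : ∀ {a b}, Adj a b → a ∈ verts

namespace FGraph

variable {V W : Type}

/-- The subgraph induced on the vertices satisfying `P`. -/
noncomputable def induce (G : FGraph V) (P : V → Prop) : FGraph V where
  verts := G.verts.filter P
  Adj a b := G.Adj a b ∧ P a ∧ P b
  symm h := ⟨G.symm h.1, h.2.2, h.2.1⟩
  loopless a h := G.loopless a h.1
  mem_of_adj h := Finset.mem_filter.mpr ⟨G.mem_of_adj h.1, h.2.1⟩

/-- The unit sphere of a vertex: the subgraph induced on its neighbors. -/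
noncomputable def unitSphere (G : FGraph V) (v : V) : FGraph V :=
  G.induce (fun w => G.Adj v w)

/-- The graph with the vertex `v` (and its edges) removed. -/
noncomputable def erase (G : FGraph V) (v : V) : FGraph V :=
  G.induce (fun w => w ≠ v)

/-- Inductive definition of contractibility: the one-point graph is contractible, and a
graph is contractible if some vertex has a contractible unit sphere and contractible
complement. -/
inductive Contractible : FGraph V → Prop
  | single (G : FGraph V) (v : V) (h : G.verts = {v}) : Contractible G
  | step (G : FGraph V) (v : V) (hv : v ∈ G.verts)
      (h1 : Contractible (G.unitSphere v)) (h2 : Contractible (G.erase v)) :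
      Contractible G

mutual
  /-- `G` is a `d`-sphere: the empty graph is the `(-1)`-sphere, and a `d`-manifold is a
  `d`-sphere if removing some vertex renders it contractible. -/
  inductive IsSphere : ℤ → FGraph V → Prop
    | empty (G : FGraph V) (h : G.verts = ∅) : IsSphere (-1) G
    | punctured (d : ℤ) (G : FGraph V) (hm : IsManifold d G) (v : V) (hv : v ∈ G.verts)
        (hc : Contractible (G.erase v)) : IsSphere d G
  /-- For `d ≥ 0`, `G` is a `d`-manifold iff every unit sphere is a `(d-1)`-sphere. -/
  inductive IsManifold : ℤ → FGraph V → Prop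
    | intro (d : ℤ) (hd : 0 ≤ d) (G : FGraph V)
        (h : ∀ v ∈ G.verts, IsSphere (d - 1) (G.unitSphere v)) : IsManifold d G
end

/-- A simplex of `G`: the vertex set of a complete subgraph. -/
def IsSimplex (G : FGraph V) (x : Finset V) : Prop :=
  x.Nonempty ∧ ↑x ⊆ G.verts ∧ ∀ a ∈ x, ∀ b ∈ x, a ≠ b → G.Adj a b

/-- The Barycentric refinement: vertices are the simplices of `G`, two being adjacent iff
one is strictly contained in the other. -/
noncomputable def barycentric (G : FGraph V) : FGraph (Finset V) where
  verts := G.verts.powerset.filter (fun x => G.IsSimplex x)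
  Adj x y := G.IsSimplex x ∧ G.IsSimplex y ∧ (x ⊂ y ∨ y ⊂ x)
  symm h := ⟨h.2.1, h.1, h.2.2.symm⟩
  loopless x h := by rcases h.2.2 with h' | h' <;> exact (ssubset_irrefl x h')
  mem_of_adj h := Finset.mem_filter.mpr ⟨Finset.mem_powerset.mpr h.1.2.1, h.1⟩

/-- Number of simplices of `G` with exactly `j` vertices (so `numSimplices G (k+1)` is
the `f`-vector entry `f_k(G)`). -/
noncomputable def numSimplices (G : FGraph V) (j : ℕ) : ℕ :=
  (G.verts.powerset.filter (fun x => G.IsSimplex x ∧ x.card = j)).card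

/-- Euler characteristic `χ(G) = Σ_{k ≥ 0} (-1)^k f_k(G)`, where `f_k` counts the
simplices with `k+1` vertices. -/
noncomputable def euler (G : FGraph V) : ℤ :=
  ∑ k ∈ Finset.range G.verts.card, (-1 : ℤ) ^ k * G.numSimplices (k + 1)

/-- The level set `{f = c}`: the subgraph of the Barycentric refinement induced by the
simplices on which `f - c` changes sign. -/
noncomputable def levelSet (G : FGraph V) (f : V → ℝ) (c : ℝ) : FGraph (Finset V) :=
  G.barycentric.induce (fun x => (∃ a ∈ x, f a - c < 0) ∧ (∃ b ∈ x, 0 < f b - c))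

/-- Graph isomorphism. -/
def Iso (G : FGraph V) (H : FGraph W) : Prop :=
  ∃ φ : V → W, Set.BijOn φ ↑G.verts ↑H.verts ∧
    ∀ a ∈ G.verts, ∀ b ∈ G.verts, (G.Adj a b ↔ H.Adj (φ a) (φ b))

/-- Zykov join of two graphs: disjoint union plus all edges between the two parts. -/
noncomputable def join (G : FGraph V) (H : FGraph W) : FGraph (V ⊕ W) where
  verts := G.verts.disjSum H.verts
  Adj a b :=
    match a, b with
    | .inl a, .inl b => G.Adj a b
    | .inr a, .inr b => H.Adj a b
    | .inl a, .inr b => a ∈ G.verts ∧ b ∈ H.verts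
    | .inr a, .inl b => b ∈ G.verts ∧ a ∈ H.verts
  symm {a b} h := by
    cases a <;> cases b <;> simp_all <;> first | exact G.symm h | exact H.symm h
  loopless a h := by
    cases a <;> simp_all <;> first | exact G.loopless _ h | exact H.loopless _ h
  mem_of_adj {a b} h := by
    cases a <;> cases b <;> simp_all [Finset.mem_disjSum] <;>
      first | exact G.mem_of_adj h | exact H.mem_of_adj h

/-- Union of two graphs on the same vertex type. -/
noncomputable def union (G H : FGraph V) : FGraph V where
  verts := G.verts ∪ H.verts
  Adj a b := G.Adj a b ∨ H.Adj a b
  symm h := h.imp G.symm H.symm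
  loopless a h := h.elim (G.loopless a) (H.loopless a)
  mem_of_adj h :=
    h.elim (fun h' => Finset.mem_union_left _ (G.mem_of_adj h'))
      (fun h' => Finset.mem_union_right _ (H.mem_of_adj h'))

/-- A `d`-ball: a graph of the form `S - v` for a `d`-sphere `S` and a vertex `v` of `S`
(up to graph isomorphism). -/
def IsBall (d : ℤ) (H : FGraph W) : Prop :=
  ∃ (S : FGraph ℕ) (v : ℕ), IsSphere d S ∧ v ∈ S.verts ∧ Iso H (S.erase v)

/-- A `d`-manifold with boundary: every unit sphere is a `(d-1)`-sphere or a `(d-1)`-ball. -/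
def IsManifoldWithBoundary (d : ℤ) (G : FGraph V) : Prop :=
  ∀ v ∈ G.verts, IsSphere (d - 1) (G.unitSphere v) ∨ IsBall (d - 1) (G.unitSphere v)

/-- The cyclic graph `C_n` on the vertex set `Fin n`. -/
def cycleGraph (n : ℕ) : FGraph (Fin n) where
  verts := Finset.univ
  Adj a b := a ≠ b ∧ ((a.val + 1) % n = b.val ∨ (b.val + 1) % n = a.val)
  symm h := ⟨h.1.symm, h.2.symm⟩
  loopless a h := h.1 rfl
  mem_of_adj _ := Finset.mem_univ _

/-- `G` is a disjoint union of cyclic graphs `C_n` with `n ≥ 4`: the vertex set splits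
into pairwise disjoint pieces, edges never cross between pieces, and each piece induces
a graph isomorphic to a `C_n` with `n ≥ 4`. -/
def IsDisjointUnionOfCycles (G : FGraph V) : Prop :=
  ∃ P : Finset (Finset V),
    (∀ S ∈ P, ↑S ⊆ G.verts) ∧
    (∀ S ∈ P, ∀ T ∈ P, S ≠ T → Disjoint S T) ∧
    (∀ v ∈ G.verts, ∃ S ∈ P, v ∈ S) ∧
    (∀ a b, G.Adj a b → ∀ S ∈ P, a ∈ S → b ∈ S) ∧
    (∀ S ∈ P, ∃ n, 4 ≤ n ∧ Iso (G.induce (· ∈ S)) (cycleGraph n))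

/-- Poincaré–Hopf index `i_f(v) = 1 - χ(S^-_f(v))`. -/
noncomputable def pindex (G : FGraph V) (f : V → ℝ) (v : V) : ℤ :=
  1 - ((G.unitSphere v).induce (fun w => f w < f v)).euler

/-- Curvature `K(v) = Σ_{k ≥ 0} (-1)^k f_{k-1}(S(v))/(k+1)` with `f_{-1} = 1`. -/
noncomputable def curvature (G : FGraph V) (v : V) : ℝ :=
  ∑ k ∈ Finset.range (G.verts.card + 1),
    (-1 : ℝ) ^ k * (if k = 0 then 1 else ((G.unitSphere v).numSimplices k : ℝ)) / (k + 1)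

end FGraph

/-- `sign(a + i b) = sign(a) + i sign(b)`. -/
noncomputable def csgn (z : ℂ) : ℂ :=
  ⟨Real.sign z.re, Real.sign z.im⟩

/-- The set `U = {1+i, 1-i, -1+i, -1-i}` of possible values of `csgn`. -/
noncomputable def signU : Finset ℂ :=
  {1 + Complex.I, 1 - Complex.I, -1 + Complex.I, -1 - Complex.I}

namespace FGraph

variable {V : Type}

/-- The set of values of `sign(ψ - c)` attained on the finite vertex set `x`. -/
noncomputable def signValues (ψ : V → ℂ) (c : ℂ) (x : Finset V) : Finset ℂ :=
  x.image (fun v => csgn (ψ v - c))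

/-- The level set `{ψ = c}` of a complex-valued function: the subgraph of the Barycentric
refinement induced by the simplices on which `sign(ψ - c)` takes at least three distinct
values, including `-1+i` and `1-i`. -/
noncomputable def complexLevelSet (G : FGraph V) (ψ : V → ℂ) (c : ℂ) : FGraph (Finset V) :=
  G.barycentric.induce (fun x =>
    3 ≤ (signValues ψ c x).card ∧
    (-1 + Complex.I) ∈ signValues ψ c x ∧ (1 - Complex.I) ∈ signValues ψ c x)

/-- The level set `{ψ = 0}_e` for a two-element subset `e ⊆ U`: the subgraph of the
Barycentric refinement induced by the simplices on which `sign(ψ)` attains both values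
of `e` and at least three distinct values in total. -/
noncomputable def complexLevelSetE (G : FGraph V) (ψ : V → ℂ) (e : Finset ℂ) :
    FGraph (Finset V) :=
  G.barycentric.induce (fun x =>
    (∀ u ∈ e, u ∈ signValues ψ 0 x) ∧ 3 ≤ (signValues ψ 0 x).card)

/-- `Ψ^{-1}(t)`: the subgraph of the Barycentric refinement induced by the simplices on
which `sign(ψ)` attains all values of `t`. -/
noncomputable def signPreimage (G : FGraph V) (ψ : V → ℂ) (t : Finset ℂ) :
    FGraph (Finset V) :=
  G.barycentric.induce (fun x => ∀ u ∈ t, u ∈ signValues ψ 0 x)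

/-- The sign vectors of `F - c` attained on the finite vertex set `x`. -/
noncomputable def vecSignValues {k : ℕ} (F : V → Fin k → ℝ) (c : Fin k → ℝ)
    (x : Finset V) : Finset (Fin k → ℝ) :=
  x.image (fun v j => Real.sign (F v j - c j))

/-- The level set `{F = c}` of an `ℝ^k`-valued function: the subgraph of the Barycentric
refinement induced by the simplices on which the sign vector of `F - c` takes at least
`k+1` distinct values, including the `k` vectors `(1,…,1,-1,1,…,1)`. -/
noncomputable def vecLevelSet (G : FGraph V) {k : ℕ} (F : V → Fin k → ℝ) (c : Fin k → ℝ) :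
    FGraph (Finset V) :=
  G.barycentric.induce (fun x =>
    k + 1 ≤ (vecSignValues F c x).card ∧
    ∀ j : Fin k, (fun i => if i = j then (-1 : ℝ) else 1) ∈ vecSignValues F c x)

end FGraph

/-- The complete graph on `Fin n`. -/
def completeFGraph (n : ℕ) : FGraph (Fin n) where
  verts := Finset.univ
  Adj a b := a ≠ b
  symm h := h.symm
  loopless a h := h rfl
  mem_of_adj _ := Finset.mem_univ _

/-- Stirling numbers of the second kind. -/
def stirling2 : ℕ → ℕ → ℕ
  | 0, 0 => 1
  | 0, _ + 1 => 0
  | _ + 1, 0 => 0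
  | n + 1, m + 1 => (m + 1) * stirling2 n (m + 1) + stirling2 n m

namespace OrderComplex

/-- The elements of `s` strictly comparable to `a`. -/
noncomputable def comp {α : Type} [PartialOrder α] (a : α) (s : Finset α) : Finset α :=
  s.filter (fun b => a < b ∨ b < a)

/-- The finset `s` with `a` removed. -/
noncomputable def del {α : Type} (a : α) (s : Finset α) : Finset α :=
  s.filter (fun b => b ≠ a)

@[simp] theorem mem_del {α : Type} {a b : α} {s : Finset α} :
    b ∈ del a s ↔ b ∈ s ∧ b ≠ a := by simp [del]

theorem del_image {α β : Type} [DecidableEq β] {s : Finset α} {f : α → β}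
    (hf : Set.InjOn f s) {a : α} (ha : a ∈ s) :
    del (f a) (s.image f) = (del a s).image f := by
  ext b
  simp only [mem_del, Finset.mem_image]
  constructor
  · rintro ⟨⟨c, hc, rfl⟩, h⟩
    exact ⟨c, ⟨hc, fun h' => h (h' ▸ rfl)⟩, rfl⟩
  · rintro ⟨c, ⟨hc, h⟩, rfl⟩
    exact ⟨⟨c, hc, rfl⟩, fun h' => h (hf hc ha h')⟩

/-- Contractibility of the comparability graph of a finite poset. -/
inductive PosetContractible {α : Type} [PartialOrder α] : Finset α → Prop
  | single (a : α) : PosetContractible {a}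
  | step (s : Finset α) (a : α) (ha : a ∈ s) (h1 : PosetContractible (comp a s))
      (h2 : PosetContractible (del a s)) : PosetContractible s

/-- The comparability graph of a finite poset is an `(n-1)`-sphere. -/
def PosetSphere {α : Type} [PartialOrder α] : ℕ → Finset α → Prop
  | 0, s => s = ∅
  | n + 1, s => (∀ a ∈ s, PosetSphere n (comp a s)) ∧ ∃ a ∈ s, PosetContractible (del a s)

section Poset

variable {α β : Type} [PartialOrder α] [PartialOrder β]

@[simp] theorem mem_comp {a b : α} {s : Finset α} :
    b ∈ comp a s ↔ b ∈ s ∧ (a < b ∨ b < a) := by simp [comp]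

theorem PosetContractible.of_apex {s : Finset α} {a : α} (ha : a ∈ s)
    (h : ∀ b ∈ s, b ≠ a → a < b ∨ b < a) : PosetContractible s := by
  induction hn : s.card using Nat.strong_induction_on generalizing s with
  | _ n ih =>
    by_cases hs : s = {a}
    · rw [hs]; exact .single a
    · obtain ⟨b, hb, hba⟩ : ∃ b ∈ s, b ≠ a := by
        by_contra! hc
        exact hs (Finset.eq_singleton_iff_unique_mem.2 ⟨ha, hc⟩)
      refine .step s b hb (ih _ ?_ (s := comp b s) ?_ ?_ rfl)
        (ih _ ?_ (s := del b s) ?_ ?_ rfl)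
      · rw [← hn]
        refine Finset.card_lt_card ⟨fun c hc => (mem_comp.1 hc).1, fun hc => ?_⟩
        simpa using hc hb
      · exact mem_comp.2 ⟨ha, (h b hb hba).symm⟩
      · exact fun c hc => h c (mem_comp.1 hc).1
      · rw [← hn]
        refine Finset.card_lt_card ⟨fun c hc => (mem_del.1 hc).1, fun hc => ?_⟩
        simpa using hc hb
      · exact mem_del.2 ⟨ha, hba.symm⟩
      · exact fun c hc => h c (mem_del.1 hc).1

theorem comp_union_left [DecidableEq α] {s t : Finset α}
    (h : ∀ a ∈ s, ∀ b ∈ t, a < b ∨ b < a) {a : α} (ha : a ∈ s) :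
    comp a (s ∪ t) = comp a s ∪ t := by
  ext b
  have := h a ha b
  simp only [mem_comp, Finset.mem_union]
  tauto

theorem del_union_left [DecidableEq α] {s t : Finset α}
    (h : ∀ a ∈ s, ∀ b ∈ t, a < b ∨ b < a) {a : α} (ha : a ∈ s) :
    del a (s ∪ t) = del a s ∪ t := by
  ext b
  have : b ∈ t → b ≠ a := by
    rintro hb rfl
    simpa using h b ha b hb
  simp only [mem_del, Finset.mem_union]
  tauto

theorem PosetContractible.join [DecidableEq α] {s t : Finset α} (hs : PosetContractible s)
    (h : ∀ a ∈ s, ∀ b ∈ t, a < b ∨ b < a) : PosetContractible (s ∪ t) := by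
  induction hs with
  | single a =>
    refine .of_apex (a := a) (by simp) fun b hb hba => ?_
    simp only [Finset.mem_union, Finset.mem_singleton] at hb
    exact h a (by simp) b (hb.resolve_left hba)
  | step s a ha _ _ ih1 ih2 =>
    refine .step _ a (Finset.mem_union_left _ ha) ?_ ?_
    · rw [comp_union_left h ha]
      exact ih1 fun c hc => h c (mem_comp.1 hc).1
    · rw [del_union_left h ha]
      exact ih2 fun c hc => h c (mem_del.1 hc).1

theorem PosetSphere.join [DecidableEq α] {m n : ℕ} {s t : Finset α} (hs : PosetSphere m s)
    (ht : PosetSphere n t) (h : ∀ a ∈ s, ∀ b ∈ t, a < b ∨ b < a) :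
    PosetSphere (m + n) (s ∪ t) := by
  induction hk : m + n generalizing m n s t with
  | zero =>
    obtain ⟨rfl, rfl⟩ : m = 0 ∧ n = 0 := by omega
    have h1 : s = ∅ := hs
    have h2 : t = ∅ := ht
    simp [h1, h2, PosetSphere]
  | succ k ih =>
    rcases m with _ | m
    · have h1 : s = ∅ := hs
      obtain rfl : n = k + 1 := by omega
      rwa [h1, Finset.empty_union]
    rcases n with _ | n
    · have h1 : t = ∅ := ht
      obtain rfl : m = k := by omega
      rwa [h1, Finset.union_empty]
    refine ⟨fun a ha => ?_, ?_⟩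
    · rcases Finset.mem_union.1 ha with ha | ha
      · rw [comp_union_left h ha]
        exact ih (hs.1 a ha) ht (fun c hc => h c (mem_comp.1 hc).1) (by omega)
      · rw [Finset.union_comm, comp_union_left (fun a ha b hb => (h b hb a ha).symm) ha,
          Finset.union_comm]
        exact ih hs (ht.1 a ha) (fun c hc d hd => h c hc d (mem_comp.1 hd).1) (by omega)
    · obtain ⟨a, ha, hc⟩ := hs.2
      refine ⟨a, Finset.mem_union_left _ ha, ?_⟩
      rw [del_union_left h ha]
      exact hc.join fun c hc => h c (mem_del.1 hc).1

theorem comp_image [DecidableEq β] {s : Finset α} {f : α → β}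
    (hf : ∀ a ∈ s, ∀ b ∈ s, f a < f b ↔ a < b) {a : α} (ha : a ∈ s) :
    comp (f a) (s.image f) = (comp a s).image f := by
  ext b
  simp only [mem_comp, Finset.mem_image]
  constructor
  · rintro ⟨⟨c, hc, rfl⟩, h⟩
    exact ⟨c, ⟨hc, h.imp (hf a ha c hc).1 (hf c hc a ha).1⟩, rfl⟩
  · rintro ⟨c, ⟨hc, h⟩, rfl⟩
    exact ⟨⟨c, hc, rfl⟩, h.imp (hf a ha c hc).2 (hf c hc a ha).2⟩

theorem PosetContractible.image [DecidableEq β] {s : Finset α} (hs : PosetContractible s)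
    {f : α → β} (hi : Set.InjOn f s) (hf : ∀ a ∈ s, ∀ b ∈ s, f a < f b ↔ a < b) :
    PosetContractible (s.image f) := by
  induction hs with
  | single a => rw [Finset.image_singleton]; exact .single _
  | step s a ha _ _ ih1 ih2 =>
    refine .step _ (f a) (Finset.mem_image_of_mem f ha) ?_ ?_
    · rw [comp_image hf ha]
      exact ih1 (hi.mono fun c hc => (mem_comp.1 hc).1)
        fun b hb c hc => hf b (mem_comp.1 hb).1 c (mem_comp.1 hc).1
    · rw [del_image hi ha]
      exact ih2 (hi.mono fun c hc => (mem_del.1 hc).1)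
        fun b hb c hc => hf b (mem_del.1 hb).1 c (mem_del.1 hc).1

theorem PosetSphere.image [DecidableEq β] {n : ℕ} {s : Finset α} (hs : PosetSphere n s)
    {f : α → β} (hi : Set.InjOn f s) (hf : ∀ a ∈ s, ∀ b ∈ s, f a < f b ↔ a < b) :
    PosetSphere n (s.image f) := by
  induction n generalizing s with
  | zero =>
    have h : s = ∅ := hs
    simp [h, PosetSphere]
  | succ n ih =>
    obtain ⟨h1, a, ha, h2⟩ := hs
    refine ⟨fun b hb => ?_, f a, Finset.mem_image_of_mem f ha, ?_⟩
    · obtain ⟨c, hc, rfl⟩ := Finset.mem_image.1 hb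
      rw [comp_image hf hc]
      exact ih (h1 c hc) (hi.mono fun c hc => (mem_comp.1 hc).1)
        fun b hb c hc => hf b (mem_comp.1 hb).1 c (mem_comp.1 hc).1
    · rw [del_image hi ha]
      exact h2.image (hi.mono fun c hc => (mem_del.1 hc).1)
        fun b hb c hc => hf b (mem_del.1 hb).1 c (mem_del.1 hc).1

/-- The comparability graph of a finite poset. -/
def graph (s : Finset α) : FGraph α where
  verts := s
  Adj a b := a ∈ s ∧ b ∈ s ∧ (a < b ∨ b < a)
  symm h := ⟨h.2.1, h.1, h.2.2.symm⟩
  loopless a h := by simpa using h.2.2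
  mem_of_adj h := h.1

end Poset

end OrderComplex

namespace FGraph

open OrderComplex

section Graphs

variable {V : Type}

theorem ext' {G H : FGraph V} (h1 : ∀ a, a ∈ G.verts ↔ a ∈ H.verts)
    (h2 : ∀ a b, G.Adj a b ↔ H.Adj a b) : G = H := by
  cases G; cases H
  congr
  · exact Finset.ext h1
  · funext a b; exact propext (h2 a b)

theorem mem_unitSphere {G : FGraph V} {v w : V} : w ∈ (G.unitSphere v).verts ↔ G.Adj v w := by
  simp only [unitSphere, induce, Finset.mem_filter]
  exact ⟨fun h => h.2, fun h => ⟨G.mem_of_adj (G.symm h), h⟩⟩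

/-- An `(n-1)`-sphere, by recursion on a natural number. -/
def SphereOfRank : ℕ → FGraph V → Prop
  | 0, G => G.verts = ∅
  | n + 1, G => (∀ v ∈ G.verts, SphereOfRank n (G.unitSphere v)) ∧
      ∃ v ∈ G.verts, Contractible (G.erase v)

theorem IsSphere.cases {d : ℤ} {G : FGraph V} (h : IsSphere d G) :
    (d = -1 ∧ G.verts = ∅) ∨ (0 ≤ d ∧ (∀ v ∈ G.verts, IsSphere (d - 1) (G.unitSphere v)) ∧
      ∃ v ∈ G.verts, Contractible (G.erase v)) := by
  cases h with
  | empty _ h => exact .inl ⟨rfl, h⟩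
  | punctured _ _ hm v hv hc =>
    cases hm with
    | intro _ hd _ h => exact .inr ⟨hd, h, v, hv, hc⟩

theorem IsSphere.sphereOfRank {n : ℕ} {G : FGraph V} (h : IsSphere ((n : ℤ) - 1) G) :
    SphereOfRank n G := by
  induction n generalizing G with
  | zero =>
    rcases h.cases with h | h
    · exact h.2
    · simp at h
  | succ n ih =>
    rcases h.cases with h | ⟨-, h1, h2⟩
    · omega
    · refine ⟨fun v hv => ih ?_, h2⟩
      convert h1 v hv using 1
      push_cast; ring

theorem SphereOfRank.isSphere {n : ℕ} {G : FGraph V} (h : SphereOfRank n G) :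
    IsSphere ((n : ℤ) - 1) G := by
  induction n generalizing G with
  | zero => simpa using IsSphere.empty G h
  | succ n ih =>
    obtain ⟨h1, v, hv, h2⟩ := h
    refine .punctured _ _ (.intro _ (by simp) _ fun w hw => ?_) v hv h2
    convert ih (h1 w hw) using 1
    push_cast; ring

variable {α : Type} [PartialOrder α]

theorem unitSphere_graph {s : Finset α} {a : α} (ha : a ∈ s) :
    (graph s).unitSphere a = graph (comp a s) := by
  refine ext' (fun b => ?_) fun b c => ?_
  · rw [mem_unitSphere]
    simp only [graph, mem_comp]
    tauto
  · simp only [graph, unitSphere, induce, mem_comp]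
    tauto

theorem erase_graph {s : Finset α} {a : α} : (graph s).erase a = graph (del a s) := by
  refine ext' (fun b => ?_) fun b c => ?_ <;>
    simp only [graph, erase, induce, Finset.mem_filter, mem_del]
  tauto

theorem _root_.OrderComplex.PosetContractible.contractible {s : Finset α}
    (h : PosetContractible s) : Contractible (graph s) := by
  induction h with
  | single a => exact .single _ a rfl
  | step s a ha _ _ ih1 ih2 =>
    exact .step _ a ha (by rwa [unitSphere_graph ha]) (by rwa [erase_graph])

theorem _root_.OrderComplex.PosetSphere.sphereOfRank {n : ℕ} {s : Finset α}
    (h : PosetSphere n s) : SphereOfRank n (graph s) := by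
  induction n generalizing s with
  | zero => exact h
  | succ n ih =>
    obtain ⟨h1, a, ha, h2⟩ := h
    refine ⟨fun b hb => ?_, a, ha, ?_⟩
    · rw [unitSphere_graph (s := s) hb]; exact ih (h1 b hb)
    · rw [erase_graph]; exact h2.contractible

end Graphs

variable {V : Type}

/-- Removing all members through `v` from a family closed under erasing `v` does not affect
contractibility: they can be removed in increasing order, each through a cone. -/
theorem posetContractible_of_filter_notMem {v : V} {A : Finset (Finset V)}
    (hA : ∀ x ∈ A, v ∈ x → x.erase v ∈ A)
    (h : PosetContractible (A.filter (fun x => v ∉ x))) : PosetContractible A := by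
  induction hn : A.card using Nat.strong_induction_on generalizing A with
  | _ n ih =>
    by_cases hv : ∃ x ∈ A, v ∈ x
    · obtain ⟨x, hx, hmin⟩ := (A.filter (fun x => v ∈ x)).exists_minimal
        (by simpa [Finset.Nonempty] using hv)
      rw [Finset.mem_filter] at hx
      refine .step A x hx.1 (.of_apex (a := x.erase v) ?_ ?_) (ih _ ?_ (A := del x A) ?_ ?_ rfl)
      · exact mem_comp.2 ⟨hA x hx.1 hx.2, .inr (Finset.erase_ssubset hx.2)⟩
      · intro z hz hzx
        rcases (mem_comp.1 hz).2 with h' | h'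
        · exact .inl (lt_trans (Finset.erase_ssubset hx.2) h')
        · refine .inr (lt_of_le_of_ne (Finset.subset_erase.2 ⟨h'.le, fun hvz => ?_⟩) hzx)
          exact h'.not_ge (hmin (Finset.mem_filter.2 ⟨(mem_comp.1 hz).1, hvz⟩) h'.le)
      · rw [← hn]
        refine Finset.card_lt_card ⟨fun c hc => (mem_del.1 hc).1, fun hc => ?_⟩
        simpa using hc hx.1
      · intro z hz hvz
        rw [mem_del] at hz ⊢
        refine ⟨hA z hz.1 hvz, ?_⟩
        rintro rfl
        simp at hx
      · convert h using 1
        ext z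
        simp only [Finset.mem_filter, mem_del]
        constructor
        · tauto
        · rintro ⟨h1, h2⟩
          exact ⟨⟨h1, by rintro rfl; exact h2 hx.2⟩, h2⟩
    · push Not at hv
      rwa [Finset.filter_true_of_mem hv] at h

/-- The nonempty proper subsets of `x`. -/
noncomputable def boundary (x : Finset V) : Finset (Finset V) :=
  x.powerset.filter (fun y => y.Nonempty ∧ y ⊂ x)

@[simp] theorem mem_boundary {x y : Finset V} : y ∈ boundary x ↔ y.Nonempty ∧ y ⊂ x := by
  simp only [boundary, Finset.mem_filter, Finset.mem_powerset]
  exact ⟨fun h => h.2, fun h => ⟨h.2.1, h⟩⟩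

theorem union_injOn {x : Finset V} {A : Finset (Finset V)} (hA : ∀ z ∈ A, Disjoint x z) :
    Set.InjOn (fun z => x ∪ z) (A : Set (Finset V)) := by
  intro a ha b hb h
  have h' : x ∪ a = x ∪ b := h
  rw [← Finset.union_sdiff_cancel_left (hA a ha), h',
    Finset.union_sdiff_cancel_left (hA b hb)]

theorem union_ssubset_union_iff {x a b : Finset V} (ha : Disjoint x a) (hb : Disjoint x b) :
    x ∪ a < x ∪ b ↔ a < b := by
  have key : ∀ {a b : Finset V}, Disjoint x a → (x ∪ a ≤ x ∪ b ↔ a ≤ b) := by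
    intro a b ha
    refine ⟨fun h c hc => ?_, fun h => Finset.union_subset_union_right h⟩
    have := h (Finset.mem_union_right x hc)
    exact (Finset.mem_union.1 this).resolve_left fun hcx => Finset.disjoint_left.1 ha hcx hc
  rw [lt_iff_le_not_ge, lt_iff_le_not_ge, key ha, key hb]

theorem comp_boundary {x y : Finset V} (hy : y ∈ boundary x) :
    comp y (boundary x) = boundary y ∪ (boundary (x \ y)).image (fun z => y ∪ z) := by
  rw [mem_boundary] at hy
  ext z
  simp only [mem_comp, mem_boundary, Finset.mem_union, Finset.mem_image]
  constructor
  · rintro ⟨⟨h1, h2⟩, h | h⟩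
    · refine .inr ⟨z \ y, ⟨Finset.sdiff_nonempty.2 h.2, ?_⟩, Finset.union_sdiff_of_subset h.1⟩
      refine ⟨Finset.sdiff_subset_sdiff h2.1 le_rfl, fun h' => h2.2 fun c hc => ?_⟩
      by_cases hcy : c ∈ y
      · exact h.1 hcy
      · exact (Finset.mem_sdiff.1 (h' (Finset.mem_sdiff.2 ⟨hc, hcy⟩))).1
    · exact .inl ⟨h1, h⟩
  · rintro (⟨h1, h2⟩ | ⟨w, ⟨h1, h2⟩, rfl⟩)
    · exact ⟨⟨h1, h2.trans hy.2⟩, .inr h2⟩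
    · have hd : Disjoint y w := Finset.disjoint_of_subset_right h2.1 Finset.disjoint_sdiff
      refine ⟨⟨hy.1.mono Finset.subset_union_left, ?_⟩, .inl ?_⟩
      · have := (union_ssubset_union_iff hd Finset.disjoint_sdiff).2 h2
        rwa [Finset.union_sdiff_of_subset hy.2.1] at this
      · have := (union_ssubset_union_iff (Finset.disjoint_empty_right y) hd).2
          (Finset.empty_ssubset.2 h1)
        rwa [Finset.union_empty] at this

theorem posetSphere_boundary {n : ℕ} {x : Finset V} (hx : x.card = n + 1) :
    PosetSphere n (boundary x) := by
  induction n using Nat.strong_induction_on generalizing x with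
  | _ n ih =>
    rcases n with _ | n
    · obtain ⟨a, rfl⟩ := Finset.card_eq_one.1 hx
      refine Finset.eq_empty_of_forall_notMem fun y hy => ?_
      rw [mem_boundary, Finset.ssubset_singleton_iff] at hy
      exact hy.1.ne_empty hy.2
    refine ⟨fun y hy => ?_, ?_⟩
    · rw [comp_boundary hy]
      rw [mem_boundary] at hy
      have h1 := hy.1.card_pos
      have h2 := Finset.card_lt_card hy.2
      have h3 := Finset.card_sdiff_of_subset hy.2.1
      have hd : ∀ z ∈ boundary (x \ y), Disjoint y z := fun z hz =>
        Finset.disjoint_of_subset_right (mem_boundary.1 hz).2.1 Finset.disjoint_sdiff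
      have e : n = (y.card - 1) + ((x \ y).card - 1) := by omega
      rw [e]
      refine (ih _ (by omega) (by omega)).join ((ih _ (by omega) (by omega)).image
        (union_injOn hd) fun a ha b hb => union_ssubset_union_iff (hd a ha) (hd b hb)) ?_
      intro a ha b hb
      obtain ⟨z, -, rfl⟩ := Finset.mem_image.1 hb
      exact .inl (lt_of_lt_of_le (mem_boundary.1 ha).2 Finset.subset_union_left)
    · obtain ⟨v, hv⟩ := Finset.card_pos.1 (by omega : 0 < x.card)
      have hlt : ∀ {y : Finset V}, y ⊆ x → y.card < x.card → y ⊂ x := fun h1 h2 =>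
        Finset.ssubset_iff_subset_ne.2 ⟨h1, by rintro rfl; omega⟩
      have hne : (x.erase v).Nonempty := by
        rw [← Finset.card_pos, Finset.card_erase_of_mem hv]; omega
      refine ⟨{v}, mem_boundary.2 ⟨Finset.singleton_nonempty v,
        hlt (Finset.singleton_subset_iff.2 hv) (by simp; omega)⟩, ?_⟩
      refine posetContractible_of_filter_notMem (v := v) ?_ (.of_apex (a := x.erase v) ?_ ?_)
      · intro y hy hvy
        simp only [mem_del, mem_boundary] at hy ⊢
        refine ⟨⟨?_, (Finset.erase_ssubset hvy).trans hy.1.2⟩, ?_⟩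
        · exact (Finset.erase_nonempty hvy).2
            ((Finset.nontrivial_iff_ne_singleton hvy).2 hy.2)
        · intro h
          have := Finset.mem_singleton_self v
          rw [← h] at this
          simp at this
      · simp only [Finset.mem_filter, mem_del, mem_boundary]
        refine ⟨⟨⟨hne, Finset.erase_ssubset hv⟩, ?_⟩, by simp⟩
        intro h
        have := Finset.mem_singleton_self v
        rw [← h] at this
        simp at this
      · intro y hy hyx
        simp only [Finset.mem_filter, mem_del, mem_boundary] at hy
        exact .inr (lt_of_le_of_ne (Finset.subset_erase.2 ⟨hy.1.1.2.1, hy.2⟩) hyx)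

theorem mem_barycentric {G : FGraph V} {x : Finset V} :
    x ∈ G.barycentric.verts ↔ G.IsSimplex x := by
  simp only [barycentric, Finset.mem_filter, Finset.mem_powerset]
  exact ⟨fun h => h.2, fun h => ⟨h.2.1, h⟩⟩

theorem IsSimplex.mono {G : FGraph V} {x y : Finset V} (hx : G.IsSimplex x) (h : y ⊆ x)
    (hy : y.Nonempty) : G.IsSimplex y :=
  ⟨hy, fun _ ha => hx.2.1 (h ha), fun a ha b hb => hx.2.2 a (h ha) b (h hb)⟩

theorem isSimplex_singleton {G : FGraph V} {v : V} (hv : v ∈ G.verts) : G.IsSimplex {v} := by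
  refine ⟨Finset.singleton_nonempty v, by simpa using hv, fun a ha b hb hab => ?_⟩
  rw [Finset.mem_singleton] at ha hb
  exact absurd (ha.trans hb.symm) hab

theorem isSimplex_induce {G : FGraph V} {P : V → Prop} {x : Finset V} :
    (G.induce P).IsSimplex x ↔ G.IsSimplex x ∧ ∀ a ∈ x, P a := by
  constructor
  · rintro ⟨h1, h2, h3⟩
    have h2' : ∀ a ∈ x, a ∈ G.verts ∧ P a := fun a ha => Finset.mem_filter.1 (h2 ha)
    exact ⟨⟨h1, fun a ha => (h2' a ha).1, fun a ha b hb hab => (h3 a ha b hb hab).1⟩,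
      fun a ha => (h2' a ha).2⟩
  · rintro ⟨⟨h1, h2, h3⟩, h4⟩
    exact ⟨h1, fun a ha => Finset.mem_filter.2 ⟨h2 ha, h4 a ha⟩,
      fun a ha b hb hab => ⟨h3 a ha b hb hab, h4 a ha, h4 b hb⟩⟩

/-- The subgraph induced on the common neighbors of `x`. -/
noncomputable def link (G : FGraph V) (x : Finset V) : FGraph V :=
  G.induce (fun w => ∀ a ∈ x, G.Adj a w)

theorem link_singleton (G : FGraph V) (v : V) : G.link {v} = G.unitSphere v := by
  simp [link, unitSphere]

/-- The simplices of `G` strictly containing `x`. -/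
noncomputable def above (G : FGraph V) (x : Finset V) : Finset (Finset V) :=
  G.barycentric.verts.filter (fun z => x ⊂ z)

@[simp] theorem mem_above {G : FGraph V} {x z : Finset V} :
    z ∈ G.above x ↔ G.IsSimplex z ∧ x ⊂ z := by
  simp [above, mem_barycentric]

theorem disjoint_of_mem_link {G : FGraph V} {x z : Finset V}
    (hz : z ∈ (G.link x).barycentric.verts) : Disjoint x z := by
  rw [mem_barycentric, link, isSimplex_induce] at hz
  exact Finset.disjoint_left.2 fun a hax haz => G.loopless a (hz.2 a haz a hax)

theorem above_eq_image {G : FGraph V} {x : Finset V} (hx : G.IsSimplex x) :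
    G.above x = (G.link x).barycentric.verts.image (fun z => x ∪ z) := by
  ext z
  simp only [mem_above, Finset.mem_image]
  constructor
  · rintro ⟨h1, h2⟩
    refine ⟨z \ x, ?_, Finset.union_sdiff_of_subset h2.1⟩
    rw [mem_barycentric, link, isSimplex_induce]
    refine ⟨h1.mono Finset.sdiff_subset (Finset.sdiff_nonempty.2 h2.2), fun a ha b hb => ?_⟩
    rw [Finset.mem_sdiff] at ha
    exact h1.2.2 b (h2.1 hb) a ha.1 (by rintro rfl; exact ha.2 hb)
  · rintro ⟨w, hw, rfl⟩
    have hd := disjoint_of_mem_link hw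
    rw [mem_barycentric, link, isSimplex_induce] at hw
    obtain ⟨hw, hadj⟩ := hw
    refine ⟨⟨hx.1.mono Finset.subset_union_left, ?_, ?_⟩, ?_⟩
    · intro a ha
      rcases Finset.mem_union.1 (Finset.mem_coe.1 ha) with h | h
      · exact hx.2.1 h
      · exact hw.2.1 h
    · intro a ha b hb hab
      rcases Finset.mem_union.1 ha with ha | ha <;> rcases Finset.mem_union.1 hb with hb | hb
      · exact hx.2.2 a ha b hb hab
      · exact hadj b hb a ha
      · exact G.symm (hadj a ha b hb)
      · exact hw.2.2 a ha b hb hab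
    · have := (union_ssubset_union_iff (Finset.disjoint_empty_right x) hd).2
        (Finset.empty_ssubset.2 hw.1)
      rwa [Finset.union_empty] at this

theorem posetContractible_del_singleton {G : FGraph V} {v : V}
    (h : PosetContractible (G.erase v).barycentric.verts) :
    PosetContractible (del {v} G.barycentric.verts) := by
  refine posetContractible_of_filter_notMem (v := v) ?_ ?_
  · intro y hy hvy
    simp only [mem_del, mem_barycentric] at hy ⊢
    refine ⟨hy.1.mono (Finset.erase_subset _ _) ((Finset.erase_nonempty hvy).2
      ((Finset.nontrivial_iff_ne_singleton hvy).2 hy.2)), fun h => ?_⟩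
    have := Finset.mem_singleton_self v
    rw [← h] at this
    simp at this
  · convert h using 1
    ext z
    simp only [Finset.mem_filter, mem_del, mem_barycentric, erase, isSimplex_induce]
    constructor
    · rintro ⟨⟨h1, -⟩, h2⟩
      exact ⟨h1, fun a ha => by rintro rfl; exact h2 ha⟩
    · rintro ⟨h1, h2⟩
      have hv : v ∉ z := fun hv => h2 v hv rfl
      exact ⟨⟨h1, by rintro rfl; simp at hv⟩, hv⟩

theorem Contractible.barycentric {G : FGraph V} (h : Contractible G) :
    PosetContractible G.barycentric.verts := by
  induction h with
  | single G v h =>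
    have : G.barycentric.verts = {{v}} := by
      ext x
      rw [mem_barycentric, Finset.mem_singleton]
      constructor
      · rintro ⟨h1, h2, -⟩
        rw [h] at h2
        exact (Finset.subset_singleton_iff.1 h2).resolve_left h1.ne_empty
      · rintro rfl
        exact isSimplex_singleton (by simp [h])
    rw [this]
    exact .single _
  | step G v hv _ _ ih1 ih2 =>
    refine .step _ {v} (mem_barycentric.2 (isSimplex_singleton hv)) ?_
      (posetContractible_del_singleton ih2)
    have : comp {v} G.barycentric.verts = G.above {v} := by
      ext z
      simp only [mem_comp, mem_barycentric, mem_above]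
      refine and_congr_right fun hz => ⟨fun h => h.resolve_right fun h => ?_, .inl⟩
      exact hz.1.ne_empty (Finset.ssubset_singleton_iff.1 h)
    rw [this, above_eq_image (isSimplex_singleton hv)]
    refine PosetContractible.image (by rwa [link_singleton])
      (union_injOn fun z => disjoint_of_mem_link) fun a ha b hb =>
        union_ssubset_union_iff (disjoint_of_mem_link ha) (disjoint_of_mem_link hb)

theorem link_insert (G : FGraph V) (v : V) (y : Finset V) (h : ∀ a ∈ y, G.Adj v a) :
    G.link (insert v y) = (G.unitSphere v).link y := by
  refine ext' (fun b => ?_) fun b c => ?_ <;>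
    simp only [link, unitSphere, induce, Finset.mem_filter, Finset.mem_insert,
      forall_eq_or_imp] <;> grind

theorem SphereOfRank.link {n k : ℕ} {G : FGraph V}
    (hG : ∀ v ∈ G.verts, SphereOfRank n (G.unitSphere v)) {x : Finset V}
    (hx : G.IsSimplex x) (hk : x.card = k + 1) :
    ∃ j, n = j + k ∧ SphereOfRank j (G.link x) := by
  induction k generalizing n G x with
  | zero =>
    obtain ⟨v, rfl⟩ := Finset.card_eq_one.1 hk
    rw [link_singleton]
    exact ⟨n, rfl, hG v (hx.2.1 (by simp))⟩
  | succ k ih =>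
    obtain ⟨v, y, hvy, rfl, hy⟩ := Finset.card_eq_succ.1 hk
    have hadj : ∀ a ∈ y, G.Adj v a := fun a ha =>
      hx.2.2 v (by simp) a (by simp [ha]) (by rintro rfl; exact hvy ha)
    have hne : y.Nonempty := Finset.card_pos.1 (by omega)
    have hS := hG v (hx.2.1 (by simp))
    have hys : (G.unitSphere v).IsSimplex y :=
      isSimplex_induce.2 ⟨hx.mono (Finset.subset_insert v y) hne, hadj⟩
    rcases n with _ | n
    · have he : (G.unitSphere v).verts = ∅ := hS
      obtain ⟨a, ha⟩ := hne
      have := hys.2.1 ha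
      simp [he] at this
    · obtain ⟨j, hj, h⟩ := ih hS.1 hys hy
      exact ⟨j, by omega, link_insert G v y hadj ▸ h⟩

theorem SphereOfRank.barycentric {n : ℕ} {G : FGraph V} (hG : SphereOfRank n G) :
    PosetSphere n G.barycentric.verts := by
  induction n using Nat.strong_induction_on generalizing G with
  | _ n ih =>
    rcases n with _ | n
    · have he : G.verts = ∅ := hG
      refine Finset.eq_empty_of_forall_notMem fun x hx => ?_
      obtain ⟨⟨a, ha⟩, h, -⟩ := mem_barycentric.1 hx
      simpa [he] using h ha
    · obtain ⟨h1, v, hv, h2⟩ := hG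
      refine ⟨fun x hx => ?_, {v}, mem_barycentric.2 (isSimplex_singleton hv),
        posetContractible_del_singleton h2.barycentric⟩
      rw [mem_barycentric] at hx
      obtain ⟨k, hk⟩ : ∃ k, x.card = k + 1 := ⟨x.card - 1, by have := hx.1.card_pos; omega⟩
      obtain ⟨j, hj, hL⟩ := SphereOfRank.link h1 hx hk
      have hcomp : comp x G.barycentric.verts = boundary x ∪ G.above x := by
        ext z
        simp only [mem_comp, mem_barycentric, Finset.mem_union, mem_boundary, mem_above]
        constructor
        · rintro ⟨h, h' | h'⟩
          · exact .inr ⟨h, h'⟩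
          · exact .inl ⟨h.1, h'⟩
        · rintro (h | h)
          · exact ⟨hx.mono h.2.1 h.1, .inr h.2⟩
          · exact ⟨h.1, .inl h.2⟩
      rw [hcomp, hj, add_comm]
      refine (posetSphere_boundary hk).join ?_ fun a ha b hb =>
        .inl ((mem_boundary.1 ha).2.trans (mem_above.1 hb).2)
      rw [above_eq_image hx]
      exact (ih j (by omega) hL).image (union_injOn fun z => disjoint_of_mem_link)
        fun a ha b hb =>
          union_ssubset_union_iff (disjoint_of_mem_link ha) (disjoint_of_mem_link hb)

theorem barycentric_induce_below {G : FGraph V} {x : Finset V} (hx : G.IsSimplex x) :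
    G.barycentric.induce (fun y => y ⊂ x) = graph (boundary x) := by
  have key : ∀ a, a ⊂ x → (G.IsSimplex a ↔ a.Nonempty) := fun a ha =>
    ⟨fun h => h.1, fun h => hx.mono ha.1 h⟩
  refine ext' (fun a => ?_) fun a b => ?_
  · simp only [induce, Finset.mem_filter, mem_barycentric, graph, mem_boundary]
    have := key a
    tauto
  · simp only [induce, FGraph.barycentric, graph, mem_boundary]
    have := key a
    have := key b
    tauto

theorem barycentric_induce_above {G : FGraph V} {x : Finset V} :
    G.barycentric.induce (fun y => x ⊂ y) = graph (G.above x) := by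
  refine ext' (fun a => ?_) fun a b => ?_
  · simp only [induce, Finset.mem_filter, mem_barycentric, graph, mem_above]
  · simp only [induce, FGraph.barycentric, graph, mem_above]
    tauto

theorem barycentric_unitSphere_iso_join {G : FGraph V} {x : Finset V} (hx : G.IsSimplex x) :
    Iso (G.barycentric.unitSphere x) (join (G.barycentric.induce (fun y => y ⊂ x))
      (G.barycentric.induce (fun y => x ⊂ y))) := by
  have hmem : ∀ {y}, y ∈ (G.barycentric.unitSphere x).verts ↔
      G.IsSimplex y ∧ (x ⊂ y ∨ y ⊂ x) := by
    intro y
    rw [mem_unitSphere]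
    exact ⟨fun h => h.2, fun h => ⟨hx, h⟩⟩
  have hnot : ∀ {y}, x ⊂ y → ¬ y ⊂ x := fun h h' => (h.trans h').ne rfl
  refine ⟨fun y => if y ⊂ x then .inl y else .inr y, ⟨?_, ?_, ?_⟩, ?_⟩
  · intro y hy
    obtain ⟨h1, h2⟩ := hmem.1 hy
    by_cases h : y ⊂ x
    · simp [h, join, induce, mem_barycentric, h1]
    · simp [h, join, induce, mem_barycentric, h1, h2.resolve_right h]
  · intro y _ z _ h
    by_cases h1 : y ⊂ x <;> by_cases h2 : z ⊂ x <;> simp [h1, h2] at h <;> exact h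
  · rintro (y | y) hy <;>
      simp [join, induce, mem_barycentric] at hy
    · exact ⟨y, hmem.2 ⟨hy.1, .inr hy.2⟩, by simp [hy.2]⟩
    · exact ⟨y, hmem.2 ⟨hy.1, .inl hy.2⟩, by simp [hnot hy.2]⟩
  · intro a ha b hb
    obtain ⟨ha1, ha2⟩ := hmem.1 ha
    obtain ⟨hb1, hb2⟩ := hmem.1 hb
    have hA : G.barycentric.Adj a b ↔ (a ⊂ b ∨ b ⊂ a) := ⟨fun h => h.2.2, fun h => ⟨ha1, hb1, h⟩⟩
    have hxa : G.barycentric.Adj x a := ⟨hx, ha1, ha2⟩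
    have hxb : G.barycentric.Adj x b := ⟨hx, hb1, hb2⟩
    by_cases h1 : a ⊂ x <;> by_cases h2 : b ⊂ x
    · simp [h1, h2, join, induce, unitSphere, hA, hxa, hxb]
    · have h3 := hb2.resolve_right h2
      simp [h1, h2, h3, join, induce, unitSphere, hA, hxa, hxb, mem_barycentric, ha1, hb1,
        h1.trans h3]
    · have h3 := ha2.resolve_right h1
      simp [h1, h2, h3, join, induce, unitSphere, hA, hxa, hxb, mem_barycentric, ha1, hb1,
        h2.trans h3]
    · have h3 := ha2.resolve_right h1
      have h4 := hb2.resolve_right h2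
      simp [h1, h2, h3, h4, join, induce, unitSphere, hA, hxa, hxb]

end FGraph

/-- For a simplex `x` of dimension `m` in a `d`-manifold `G`, the subgraph
`S^-(x)` of the Barycentric refinement induced by the nonempty proper subsets of `x` is
an `(m-1)`-sphere, the subgraph `S^+(x)` induced by the simplices strictly containing
`x` is a `(d-m-1)`-sphere, and the unit sphere of `x` in the Barycentric refinement is
isomorphic to the Zykov join `S^-(x) ⊕ S^+(x)`. -/
theorem barycentric_unit_sphere_join {V : Type} (G : FGraph V) (d : ℤ)
    (hG : FGraph.IsManifold d G) (x : Finset V) (hx : G.IsSimplex x)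
    (m : ℕ) (hm : x.card = m + 1) :
    FGraph.IsSphere ((m : ℤ) - 1) (G.barycentric.induce (fun y => y ⊂ x)) ∧
    FGraph.IsSphere (d - m - 1) (G.barycentric.induce (fun y => x ⊂ y)) ∧
    FGraph.Iso (G.barycentric.unitSphere x)
      (FGraph.join (G.barycentric.induce (fun y => y ⊂ x))
        (G.barycentric.induce (fun y => x ⊂ y))) := by
  cases hG with
  | intro _ hd _ h =>
    lift d to ℕ using hd
    obtain ⟨j, hj, hL⟩ := FGraph.SphereOfRank.link (fun v hv => (h v hv).sphereOfRank) hx hm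
    refine ⟨?_, ?_, FGraph.barycentric_unitSphere_iso_join hx⟩
    · rw [FGraph.barycentric_induce_below hx]
      exact (FGraph.posetSphere_boundary hm).sphereOfRank.isSphere
    · rw [FGraph.barycentric_induce_above, FGraph.above_eq_image hx]
      have e : (d : ℤ) - m - 1 = (j : ℤ) - 1 := by omega
      rw [e]
      exact (hL.barycentric.image
        (FGraph.union_injOn fun z => FGraph.disjoint_of_mem_link) fun a ha b hb =>
          FGraph.union_ssubset_union_iff (FGraph.disjoint_of_mem_link ha)
            (FGraph.disjoint_of_mem_link hb)).sphereOfRank.isSphere
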